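/- Let G be a finite simple graph with vertices x_1, …, x_n and suppose a grounded L-representation of G is given, inducing the order x_1 < ⋯ < x_n. Then there exist a cycle extension H of (G,<) and a grounded L-representation of H whose restriction to the vertices x_1, …, x_n coincides with the given representation of G. -/

import Mathlib

/-- The grounded L-shape with anchor `(a, 0)`, depth `h` and width `w`:
the union of the vertical segment from `(a, 0)` to `(a, -h)` and the
horizontal segment from `(a, -h)` to `(a + w, -h)`. -/
def LShape (a h w : ℝ) : Set (ℝ × ℝ) :=
  segment ℝ ((a, 0) : ℝ × ℝ) ((a, -h) : ℝ × ℝ) ∪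
    segment ℝ ((a, -h) : ℝ × ℝ) ((a + w, -h) : ℝ × ℝ)

/-- A grounded L-representation of a simple graph `G`. -/
structure GroundedLRep {V : Type} (G : SimpleGraph V) where
  a : V → ℝ
  ht : V → ℝ
  wd : V → ℝ
  ht_pos : ∀ v, 0 < ht v
  wd_pos : ∀ v, 0 < wd v
  a_inj : Function.Injective a
  ht_inj : Function.Injective ht
  endpoint_off : ∀ u v, u ≠ v →
    ((a v + wd v, -ht v) : ℝ × ℝ) ∉ LShape (a u) (ht u) (wd u)
  adj_iff : ∀ u v, u ≠ v →
    (G.Adj u v ↔ (LShape (a u) (ht u) (wd u) ∩ LShape (a v) (ht v) (wd v)).Nonempty)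

/-- `H` is a cycle extension of the graph `G` on `Fin n` taken with its natural
vertex order: the `Sum.inl` vertices induce `G`, the `Sum.inr` vertices induce
exactly the cycle `y_0 y_1 ⋯ y_{5n-1} y_0`, and (in 0-indexed notation) each
`x_i` is adjacent either exactly to `y_{5i+4}`, or exactly to `y_{5i+3}` and
`y_{5i+4}`, among the cycle vertices. -/
def IsCycleExtension (n : ℕ) (G : SimpleGraph (Fin n))
    (H : SimpleGraph (Fin n ⊕ Fin (5 * n))) : Prop :=
  (∀ i j : Fin n, H.Adj (Sum.inl i) (Sum.inl j) ↔ G.Adj i j) ∧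
  (∀ i j : Fin (5 * n), H.Adj (Sum.inr i) (Sum.inr j) ↔
    ((i.val + 1) % (5 * n) = j.val ∨ (j.val + 1) % (5 * n) = i.val)) ∧
  (∀ i : Fin n,
    (∀ j : Fin (5 * n), H.Adj (Sum.inl i) (Sum.inr j) ↔ j.val = 5 * i.val + 4) ∨
    (∀ j : Fin (5 * n), H.Adj (Sum.inl i) (Sum.inr j) ↔
      (j.val = 5 * i.val + 3 ∨ j.val = 5 * i.val + 4)))

theorem mem_LShape_iff {a h w : ℝ} (hh : 0 < h) (hw : 0 < w) (x y : ℝ) :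
    (x, y) ∈ LShape a h w ↔
      (x = a ∧ -h ≤ y ∧ y ≤ 0) ∨ (y = -h ∧ a ≤ x ∧ x ≤ a + w) := by
  have hv : segment ℝ ((a, 0) : ℝ × ℝ) (a, -h) = {a} ×ˢ Set.Icc (-h) 0 := by
    rw [← Prod.image_mk_segment_right, segment_symm, segment_eq_Icc (by linarith)]
    ext ⟨u, v⟩
    simp [eq_comm, and_comm, and_assoc]
  have hz : segment ℝ ((a, -h) : ℝ × ℝ) (a + w, -h) = Set.Icc a (a + w) ×ˢ {-h} := by
    rw [← Prod.image_mk_segment_left, segment_eq_Icc (by linarith)]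
    ext ⟨u, v⟩
    simp [eq_comm, and_assoc]
  simp only [LShape, hv, hz, Set.mem_union, Set.mem_prod, Set.mem_singleton_iff, Set.mem_Icc]
  tauto

/-- Two grounded L-shapes with distinct anchors and depths meet exactly when the horizontal arm
of the left one crosses the vertical arm of the right one. -/
theorem LShape_inter_nonempty_iff {a h w a' h' w' : ℝ} (hh : 0 < h) (hw : 0 < w)
    (hh' : 0 < h') (hw' : 0 < w') (ha : a ≠ a') (hne : h ≠ h') :
    (LShape a h w ∩ LShape a' h' w').Nonempty ↔
      (a < a' ∧ h < h' ∧ a' ≤ a + w) ∨ (a' < a ∧ h' < h ∧ a ≤ a' + w') := by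
  constructor
  · rintro ⟨⟨x, y⟩, hx, hy⟩
    rw [mem_LShape_iff hh hw] at hx
    rw [mem_LShape_iff hh' hw'] at hy
    rcases hx with ⟨rfl, h1, h2⟩ | ⟨rfl, h1, h2⟩ <;> rcases hy with ⟨h3, h4, h5⟩ | ⟨h3, h4, h5⟩
    · exact absurd h3 ha
    · exact Or.inr ⟨lt_of_le_of_ne h4 ha.symm, lt_of_le_of_ne (by linarith) hne.symm, h5⟩
    · subst h3
      exact Or.inl ⟨lt_of_le_of_ne h1 ha, lt_of_le_of_ne (by linarith) hne, h2⟩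
    · exact absurd (neg_injective h3) hne
  · rintro (⟨h1, h2, h3⟩ | ⟨h1, h2, h3⟩)
    · refine ⟨(a', -h), ?_, ?_⟩
      · rw [mem_LShape_iff hh hw]; right; exact ⟨rfl, h1.le, h3⟩
      · rw [mem_LShape_iff hh' hw']; left; exact ⟨rfl, by linarith, by linarith⟩
    · refine ⟨(a, -h'), ?_, ?_⟩
      · rw [mem_LShape_iff hh hw]; left; exact ⟨rfl, by linarith, by linarith⟩
      · rw [mem_LShape_iff hh' hw']; right; exact ⟨rfl, h1.le, h3⟩

/-- Anchors `p k` and right ends `r k` of a chain of shapes, each reaching exactly its successor,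
such that the `(5 i + 4)`-th shape is the only one covering the point `a i`. -/
theorem exists_interleaving {n : ℕ} (a : Fin n → ℝ) (ha : StrictMono a) (M : ℝ) :
    ∃ p r : ℕ → ℝ, (∀ k l, k < l → l ≤ 5 * n → p k < p l) ∧
      (∀ k, p (k + 1) < r k) ∧ (∀ k, k + 2 ≤ 5 * n → r k < p (k + 2)) ∧
      (∀ i : Fin n, p (5 * i + 4) < a i ∧ a i < p (5 * i + 5) ∧ r (5 * i + 3) < a i) ∧
      M < p (5 * n) := by
  obtain ⟨N, hN⟩ : ∃ N, ∀ i, a i ≤ N := (Set.finite_range a).bddAbove.imp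
    fun N hN i => hN ⟨i, rfl⟩
  obtain ⟨δ, hgap, hδ1, hδ⟩ : ∃ δ : ℝ,
      (∀ i j, i < j → a i + 10 * δ < a j) ∧ δ < 1 ∧ 0 < δ := by
    have h1 : ∀ᶠ δ : ℝ in nhdsWithin 0 (Set.Ioi 0), ∀ i j, i < j → a i + 10 * δ < a j := by
      rw [Filter.eventually_all]
      intro i
      rw [Filter.eventually_all]
      intro j
      by_cases hij : i < j
      · have : Filter.Tendsto (fun δ : ℝ => a i + 10 * δ) (nhdsWithin 0 (Set.Ioi 0))
            (nhds (a i + 10 * 0)) := by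
          apply Filter.Tendsto.mono_left _ nhdsWithin_le_nhds
          exact Continuous.tendsto (by fun_prop) 0
        have h := this.eventually_lt_const (u := a j) (by simpa using ha hij)
        filter_upwards [h] with δ h _ using h
      · exact Filter.Eventually.of_forall fun _ h => absurd h hij
    have h2 : ∀ᶠ δ : ℝ in nhdsWithin 0 (Set.Ioi 0), δ < 1 :=
      nhdsWithin_le_nhds (gt_mem_nhds one_pos)
    exact (h1.and (h2.and self_mem_nhdsWithin)).exists
  let A : ℕ → ℝ := fun i => if h : i < n then a ⟨i, h⟩ else max M N + 10
  have hA : ∀ i j, i < j → j ≤ n → A i + 10 * δ < A j := by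
    intro i j hij hj
    have hi : i < n := by omega
    by_cases h : j < n
    · simpa only [A, hi, h, dif_pos] using hgap ⟨i, hi⟩ ⟨j, h⟩ hij
    · simp only [A, hi, h, dif_pos, dif_neg, not_false_eq_true]
      linarith [hN ⟨i, hi⟩, le_max_right M N]
  have hAn : A n = max M N + 10 := by simp [A]
  have hAi : ∀ i : Fin n, A i = a i := fun i => by simp [A]
  let p : ℕ → ℝ := fun k => A (k / 5) + (((k % 5 : ℕ) : ℝ) - 5) * δ
  have hp : ∀ i j, j < 5 → p (5 * i + j) = A i + ((j : ℝ) - 5) * δ := by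
    intro i j hj
    have h1 : (5 * i + j) / 5 = i := by omega
    have h2 : (5 * i + j) % 5 = j := by omega
    simp only [p, h1, h2]
  have hmono : ∀ k l, k < l → l ≤ 5 * n → p k + δ ≤ p l := by
    intro k l hkl hl
    have hk0 : (0 : ℝ) ≤ ((l % 5 : ℕ) : ℝ) := Nat.cast_nonneg _
    rcases Nat.lt_or_ge (k / 5) (l / 5) with h | h
    · have hk5 : ((k % 5 : ℕ) : ℝ) ≤ 4 := by exact_mod_cast (by omega : k % 5 ≤ 4)
      have := hA _ _ h (by omega)
      simp only [p]
      nlinarith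
    · have h1 : k / 5 = l / 5 := by omega
      have h2 : ((k % 5 : ℕ) : ℝ) + 1 ≤ ((l % 5 : ℕ) : ℝ) := by
        exact_mod_cast (by omega : k % 5 + 1 ≤ l % 5)
      simp only [p, h1]
      nlinarith
  refine ⟨p, fun k => p (k + 1) + δ / 2, ?_, ?_, ?_, ?_, ?_⟩
  · intro k l h1 h2
    linarith [hmono k l h1 h2]
  · intro k
    linarith
  · intro k hk
    linarith [hmono (k + 1) (k + 2) (by omega) hk]
  · intro i
    have h4 := hp i 4 (by norm_num)
    have h5 := hp (i + 1) 0 (by norm_num)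
    have h6 := hA i (i + 1) (by omega) (by omega)
    rw [hAi] at h4 h6
    norm_num at h4 h5
    rw [show 5 * ((i : ℕ) + 1) = 5 * i + 5 by ring] at h5
    refine ⟨by linarith, by linarith, ?_⟩
    change p (5 * i + 4) + δ / 2 < a i
    linarith
  · have := hp n 0 (by norm_num)
    norm_num at this
    linarith [le_max_left M N]

/-- Every grounded L-representation of a graph `G` on `Fin n`
inducing the natural order can be extended (keeping the shapes of the original
vertices) to a grounded L-representation of some cycle extension `H` of `G`. -/
theorem extend_groundedL_to_cycle_extension (n : ℕ) (G : SimpleGraph (Fin n))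
    (R : GroundedLRep G) (hord : ∀ i j : Fin n, i < j ↔ R.a i < R.a j) :
    ∃ H : SimpleGraph (Fin n ⊕ Fin (5 * n)), IsCycleExtension n G H ∧
      ∃ R' : GroundedLRep H, ∀ i : Fin n,
        R'.a (Sum.inl i) = R.a i ∧ R'.ht (Sum.inl i) = R.ht i ∧
        R'.wd (Sum.inl i) = R.wd i := by
  obtain ⟨M, hM⟩ : ∃ M, ∀ i, R.a i + R.wd i ≤ M :=
    (Set.finite_range fun i => R.a i + R.wd i).bddAbove.imp fun M hM i => hM ⟨i, rfl⟩
  obtain ⟨B, hB⟩ : ∃ B, ∀ i, R.ht i ≤ B :=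
    (Set.finite_range R.ht).bddAbove.imp fun M hM i => hM ⟨i, rfl⟩
  obtain ⟨ε, hεh, hε1, hε⟩ : ∃ ε : ℝ,
      (∀ i, ε * (5 * n) < R.ht i) ∧ ε * (5 * n) < |B| + 1 ∧ 0 < ε := by
    have key : ∀ c : ℝ, 0 < c → ∀ᶠ ε : ℝ in nhdsWithin 0 (Set.Ioi 0), ε * (5 * n) < c := by
      intro c hc
      have : Filter.Tendsto (fun ε : ℝ => ε * (5 * n)) (nhdsWithin 0 (Set.Ioi 0))
          (nhds (0 * (5 * n))) := by
        apply Filter.Tendsto.mono_left _ nhdsWithin_le_nhds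
        exact Continuous.tendsto (by fun_prop) 0
      exact this.eventually_lt_const (by simpa using hc)
    exact ((Filter.eventually_all.2 fun i => key _ (R.ht_pos i)).and
      ((key _ (by positivity)).and self_mem_nhdsWithin)).exists
  obtain ⟨p, r, hp, hpr, hrp, hpa, hMp⟩ :=
    exists_interleaving R.a (fun i j h => (hord i j).1 h) M
  have hBabs := le_abs_self B
  let q : ℝ := (p 2 + p 3) / 2
  let Y : ℕ → ℝ := fun k => if k = 0 then p (5 * n) else if k = 1 then q else p k
  let D : ℕ → ℝ := fun k => if k = 0 then |B| + 2 else if k = 1 then |B| + 1 else ε * k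
  let E : ℕ → ℝ := fun k => if k = 0 ∨ k = 1 then p (5 * n) + 1 else r k
  have hY0 : Y 0 = p (5 * n) := by simp [Y]
  have hY1 : Y 1 = q := by simp [Y]
  have hY2 : ∀ k, 2 ≤ k → Y k = p k := fun k hk => by
    simp only [Y]; rw [if_neg (by omega), if_neg (by omega)]
  have hD0 : D 0 = |B| + 2 := by simp [D]
  have hD1 : D 1 = |B| + 1 := by simp [D]
  have hD2 : ∀ k, 2 ≤ k → D k = ε * k := fun k hk => by
    simp only [D]; rw [if_neg (by omega), if_neg (by omega)]
  have hE0 : E 0 = p (5 * n) + 1 := by simp [E]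
  have hE1 : E 1 = p (5 * n) + 1 := by simp [E]
  have hE2 : ∀ k, 2 ≤ k → E k = r k := fun k hk => by
    simp only [E]; rw [if_neg (by omega)]
  have hq : ∀ k : ℕ, k < 5 * n → p 2 < q ∧ q < p 3 := by
    intro k hk
    have := hp 2 3 (by norm_num) (by omega)
    constructor <;> simp only [q] <;> linarith
  have hple : ∀ k l, k ≤ l → l ≤ 5 * n → p k ≤ p l := by
    intro k l h1 h2
    rcases h1.eq_or_lt with rfl | h
    · exact le_rfl
    · exact (hp k l h h2).le
  have hDsmall : ∀ k, 2 ≤ k → k < 5 * n → D k < |B| + 1 ∧ ∀ i, D k < R.ht i := by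
    intro k hk hkn
    have : ε * k ≤ ε * (5 * n) := by
      apply mul_le_mul_of_nonneg_left _ hε.le
      exact_mod_cast hkn.le
    rw [hD2 k hk]
    exact ⟨by linarith, fun i => by linarith [hεh i]⟩
  have hDmono : ∀ k l, 2 ≤ k → 2 ≤ l → (D k < D l ↔ k < l) := by
    intro k l hk hl
    rw [hD2 k hk, hD2 l hl, mul_lt_mul_iff_right₀ hε, Nat.cast_lt]
  have hYE : ∀ k, k < 5 * n → Y k < E k := by
    intro k hk
    rcases (by omega : k = 0 ∨ k = 1 ∨ 2 ≤ k) with rfl | rfl | h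
    · rw [hY0, hE0]; linarith
    · rw [hY1, hE1]; linarith [hq 1 hk, hple 3 (5 * n) (by omega) le_rfl]
    · rw [hY2 k h, hE2 k h]; linarith [hpr k, hp k (k + 1) (by omega) (by omega)]
  have hDpos : ∀ k, k < 5 * n → 0 < D k := by
    intro k hk
    rcases (by omega : k = 0 ∨ k = 1 ∨ 2 ≤ k) with rfl | rfl | h
    · rw [hD0]; positivity
    · rw [hD1]; positivity
    · rw [hD2 k h]; positivity
  have hYle : ∀ k, k < 5 * n → Y k ≤ p (5 * n) := by
    intro k hk
    rcases (by omega : k = 0 ∨ k = 1 ∨ 2 ≤ k) with rfl | rfl | h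
    · rw [hY0]
    · rw [hY1]; linarith [hq 1 hk, hple 3 (5 * n) (by omega) le_rfl]
    · rw [hY2 k h]; exact hple _ _ hk.le le_rfl
  have hap : ∀ i, R.a i < p (5 * n) := fun i => by linarith [hM i, R.wd_pos i]
  have hr_lt : ∀ k l, k + 2 ≤ l → l ≤ 5 * n → r k < p l := fun k l h1 h2 =>
    (hrp k (by omega)).trans_le (hple _ _ h1 h2)
  have hlt_r : ∀ k l, l ≤ k + 1 → k + 1 ≤ 5 * n → p l < r k := fun k l h1 h2 =>
    (hple _ _ h1 h2).trans_lt (hpr k)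
  -- the chain of cycle shapes against itself
  have hYY : ∀ k l, k < 5 * n → l < 5 * n → ((Y k < Y l ∧ D k < D l ∧ Y l ≤ E k) ↔
      (2 ≤ k ∧ l = k + 1) ∨ (k + 1 = 5 * n ∧ l = 0) ∨ (k = 2 ∧ l = 1) ∨ (k = 1 ∧ l = 0)) := by
    intro k l hk hl
    have hqk := hq k hk
    rcases (by omega : k = 0 ∨ k = 1 ∨ 2 ≤ k) with rfl | rfl | h
    · have : ¬ Y 0 < Y l := by rw [hY0]; exact not_lt.2 (hYle l hl)
      simp only [this, false_and, false_iff]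
      omega
    · rcases (by omega : l = 0 ∨ l = 1 ∨ 2 ≤ l) with rfl | rfl | h'
      · have h1 := hple 3 (5 * n) (by omega) le_rfl
        rw [hY0, hY1, hD0, hD1, hE1]
        exact ⟨fun _ => by omega, fun _ => ⟨by linarith, by linarith, by linarith⟩⟩
      · simp only [lt_irrefl, false_and, false_iff]
        omega
      · have := (hDsmall l h' hl).1
        rw [hD1]
        simp only [this.not_gt, false_and, and_false, false_iff]
        omega
    · have hs := (hDsmall k h hk).1
      rcases (by omega : l = 0 ∨ l = 1 ∨ 2 ≤ l) with rfl | rfl | h'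
      · rw [hY0, hY2 k h, hD0, hE2 k h]
        constructor
        · rintro ⟨-, -, h3⟩
          by_contra hcon
          linarith [hr_lt k (5 * n) (by omega) le_rfl]
        · intro hcon
          refine ⟨hp _ _ hk le_rfl, by linarith, ?_⟩
          exact (hlt_r k (5 * n) (by omega) (by omega)).le
      · rw [hY1, hY2 k h, hD1, hE2 k h]
        constructor
        · rintro ⟨h1, -, h3⟩
          by_contra hcon
          linarith [hple 3 k (by omega) hk.le]
        · intro hcon
          obtain rfl : k = 2 := by omega
          exact ⟨hqk.1, hs, by linarith [hpr 2]⟩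
      · rw [hDmono k l h h', hY2 k h, hY2 l h', hE2 k h]
        constructor
        · rintro ⟨-, h2, h3⟩
          by_contra hcon
          linarith [hr_lt k l (by omega) hl.le]
        · intro hcon
          exact ⟨hp _ _ (by omega) hl.le, by omega, (hlt_r k l (by omega) (by omega)).le⟩
  have hEY : ∀ k l, k < 5 * n → l < 5 * n → E k ≠ Y l := by
    intro k l hk hl
    have hqk := hq k hk
    rcases (by omega : k = 0 ∨ k = 1 ∨ 2 ≤ k) with rfl | rfl | h
    · rw [hE0]; linarith [hYle l hl]
    · rw [hE1]; linarith [hYle l hl]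
    · have key : ∀ l, l ≤ 5 * n → r k ≠ p l := by
        intro l hl
        rcases Nat.lt_or_ge (k + 1) l with h' | h'
        · exact (hr_lt k l h' hl).ne
        · exact (hlt_r k l h' (by omega)).ne'
      rw [hE2 k h]
      rcases (by omega : l = 0 ∨ l = 1 ∨ 2 ≤ l) with rfl | rfl | h'
      · rw [hY0]; exact key _ le_rfl
      · rw [hY1]; exact (hqk.2.trans (hlt_r k 3 (by omega) (by omega))).ne'
      · rw [hY2 l h']; exact key _ hl.le
  -- the cycle shapes against the given ones
  have hpa_lt : ∀ (i : Fin n) k, k ≤ 5 * i.val + 4 → p k < R.a i := fun i k hk =>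
    (hple _ _ hk (by omega)).trans_lt (hpa i).1
  have hlt_pa : ∀ (i : Fin n) k, 5 * i.val + 5 ≤ k → k ≤ 5 * n → R.a i < p k := fun i k hk hkn =>
    (hpa i).2.1.trans_le (hple _ _ hk hkn)
  have hra_lt : ∀ (i : Fin n) k, k ≤ 5 * i.val + 3 → r k < R.a i := by
    intro i k hk
    rcases hk.eq_or_lt with rfl | h
    · exact (hpa i).2.2
    · exact (hr_lt k (5 * i + 4) (by omega) (by omega)).trans (hpa i).1
  have hlt_ra : ∀ (i : Fin n) k, 5 * i.val + 4 ≤ k → k < 5 * n → R.a i < r k := fun i k hk hkn =>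
    (hlt_pa i (k + 1) (by omega) (by omega)).trans (hpr k)
  have hq_lt : ∀ i, q < R.a i := fun i =>
    (hq 0 (by have := i.isLt; omega)).2.trans (hpa_lt i 3 (by omega))
  have hYX : ∀ k (i : Fin n), k < 5 * n → ((Y k < R.a i ∧ D k < R.ht i ∧ R.a i ≤ E k) ↔
      k = 5 * i + 4) := by
    intro k i hk
    rcases (by omega : k = 0 ∨ k = 1 ∨ 2 ≤ k) with rfl | rfl | h
    · have : ¬ Y 0 < R.a i := by rw [hY0]; exact (hap i).not_gt
      simp only [this, false_and, false_iff]
      omega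
    · have : ¬ D 1 < R.ht i := by rw [hD1]; linarith [hB i]
      simp only [this, false_and, and_false, false_iff]
      omega
    · rw [hY2 k h, hE2 k h]
      constructor
      · rintro ⟨h1, -, h3⟩
        by_contra hcon
        rcases Nat.lt_or_gt_of_ne hcon with h' | h'
        · exact absurd (hra_lt i k (by omega)) h3.not_gt
        · exact absurd (hlt_pa i k (by omega) hk.le) h1.not_gt
      · intro h'
        exact ⟨hpa_lt i k h'.le, (hDsmall k h hk).2 i, (hlt_ra i k h'.ge hk).le⟩
  have hEX : ∀ k i, k < 5 * n → E k ≠ R.a i := by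
    intro k i hk
    rcases (by omega : k = 0 ∨ k = 1 ∨ 2 ≤ k) with rfl | rfl | h
    · rw [hE0]; linarith [hap i]
    · rw [hE1]; linarith [hap i]
    · rw [hE2 k h]
      rcases Nat.lt_or_ge k (5 * i + 4) with h' | h'
      · exact (hra_lt i k (by omega)).ne
      · exact (hlt_ra i k h' hk).ne'
  have hXY : ∀ i k, k < 5 * n → R.a i < Y k → Y k ≤ R.a i + R.wd i → D k < R.ht i := by
    intro i k hk h1 h2
    rcases (by omega : k = 0 ∨ k = 1 ∨ 2 ≤ k) with rfl | rfl | h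
    · rw [hY0] at h2; linarith [hM i]
    · rw [hY1] at h1; linarith [hq_lt i]
    · exact (hDsmall k h hk).2 i
  have hYinj : ∀ k l, k < 5 * n → l < 5 * n → Y k = Y l → k = l := by
    have hqp : ∀ l, 2 ≤ l → l < 5 * n → q ≠ p l := by
      intro l h hl
      rcases h.eq_or_lt with rfl | h
      · exact (hq 2 hl).1.ne'
      · exact ((hq l hl).2.trans_le (hple 3 l h hl.le)).ne
    have key : ∀ k l, l < 5 * n → k < l → Y k ≠ Y l := by
      intro k l hl hkl
      rcases (by omega : k = 0 ∨ k = 1 ∨ 2 ≤ k) with rfl | rfl | h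
      · rw [hY0]
        rcases (by omega : l = 1 ∨ 2 ≤ l) with rfl | h'
        · rw [hY1]
          exact ((hq 1 hl).2.trans_le (hple 3 (5 * n) (by omega) le_rfl)).ne'
        · rw [hY2 l h']; exact (hp l _ hl le_rfl).ne'
      · rw [hY1, hY2 l (by omega)]; exact hqp l (by omega) hl
      · rw [hY2 k h, hY2 l (by omega)]; exact (hp k l hkl hl.le).ne
    intro k l hk hl h
    rcases lt_trichotomy k l with h' | h' | h'
    · exact absurd h (key k l hl h')
    · exact h'
    · exact absurd h.symm (key l k hk h')
  have hDinj : ∀ k l, k < 5 * n → l < 5 * n → D k = D l → k = l := by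
    have key : ∀ k l, l < 5 * n → k < l → D k ≠ D l := by
      intro k l hl hkl
      rcases (by omega : l = 1 ∨ 2 ≤ l) with rfl | h'
      · obtain rfl : k = 0 := by omega
        rw [hD0, hD1]; norm_num
      · have hs := (hDsmall l h' hl).1
        rcases (by omega : k = 0 ∨ k = 1 ∨ 2 ≤ k) with rfl | rfl | h
        · rw [hD0]; linarith
        · rw [hD1]; exact hs.ne'
        · exact ((hDmono k l h h').2 hkl).ne
    intro k l hk hl h
    rcases lt_trichotomy k l with h' | h' | h'
    · exact absurd h (key k l hl h')
    · exact h'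
    · exact absurd h.symm (key l k hk h')
  have hYXne : ∀ k i, k < 5 * n → Y k ≠ R.a i := by
    intro k i hk
    rcases (by omega : k = 0 ∨ k = 1 ∨ 2 ≤ k) with rfl | rfl | h
    · rw [hY0]; exact (hap i).ne'
    · rw [hY1]; exact (hq_lt i).ne
    · rw [hY2 k h]
      rcases Nat.lt_or_ge (5 * i + 4) k with h' | h'
      · exact (hlt_pa i k h' hk.le).ne'
      · exact (hpa_lt i k h').ne
  have hDXne : ∀ k i, k < 5 * n → D k ≠ R.ht i := by
    intro k i hk
    rcases (by omega : k = 0 ∨ k = 1 ∨ 2 ≤ k) with rfl | rfl | h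
    · rw [hD0]; linarith [hB i]
    · rw [hD1]; linarith [hB i]
    · exact ((hDsmall k h hk).2 i).ne
  let av : Fin n ⊕ Fin (5 * n) → ℝ := Sum.elim R.a fun k => Y k
  let hv : Fin n ⊕ Fin (5 * n) → ℝ := Sum.elim R.ht fun k => D k
  let wv : Fin n ⊕ Fin (5 * n) → ℝ := Sum.elim R.wd fun k => E k - Y k
  have hhv : ∀ v, 0 < hv v := by
    rintro (i | k)
    · exact R.ht_pos i
    · exact hDpos k k.2
  have hwv : ∀ v, 0 < wv v := by
    rintro (i | k)
    · exact R.wd_pos i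
    · exact sub_pos.2 (hYE k k.2)
  have hav_inj : Function.Injective av := by
    rintro (i | k) (j | l) h
    · exact congrArg _ (R.a_inj h)
    · exact absurd h.symm (hYXne l i l.2)
    · exact absurd h (hYXne k j k.2)
    · exact congrArg _ (Fin.ext (hYinj k l k.2 l.2 h))
  have hhv_inj : Function.Injective hv := by
    rintro (i | k) (j | l) h
    · exact congrArg _ (R.ht_inj h)
    · exact absurd h.symm (hDXne l i l.2)
    · exact absurd h (hDXne k j k.2)
    · exact congrArg _ (Fin.ext (hDinj k l k.2 l.2 h))
  let H : SimpleGraph (Fin n ⊕ Fin (5 * n)) :=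
    { Adj := fun u v => u ≠ v ∧
        (LShape (av u) (hv u) (wv u) ∩ LShape (av v) (hv v) (wv v)).Nonempty
      symm := ⟨fun u v h => ⟨h.1.symm, by rw [Set.inter_comm]; exact h.2⟩⟩
      loopless := ⟨fun u h => h.1 rfl⟩ }
  have hH : ∀ u v, u ≠ v → (H.Adj u v ↔
      (av u < av v ∧ hv u < hv v ∧ av v ≤ av u + wv u) ∨
      (av v < av u ∧ hv v < hv u ∧ av u ≤ av v + wv v)) := by
    intro u v huv
    rw [← LShape_inter_nonempty_iff (hhv u) (hwv u) (hhv v) (hwv v) (hav_inj.ne huv)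
      (hhv_inj.ne huv)]
    exact and_iff_right huv
  refine ⟨H, ⟨?_, ?_, ?_⟩, ⟨av, hv, wv, hhv, hwv, hav_inj, hhv_inj, ?_, ?_⟩, fun i =>
    ⟨rfl, rfl, rfl⟩⟩
  · intro i j
    by_cases hij : i = j
    · simp [hij]
    · rw [R.adj_iff i j hij]
      exact and_iff_right (Sum.inl_injective.ne hij)
  · intro k l
    by_cases hkl : k = l
    · subst hkl
      have hk := k.2
      simp only [SimpleGraph.irrefl, or_self, false_iff]
      rcases (by omega : k.val + 1 = 5 * n ∨ k.val + 1 < 5 * n) with h | h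
      · rw [h, Nat.mod_self]; omega
      · rw [Nat.mod_eq_of_lt h]; omega
    · have hmod : ∀ k l : Fin (5 * n), (k.val + 1) % (5 * n) = l.val ↔
          k.val + 1 = l.val ∨ (k.val + 1 = 5 * n ∧ l.val = 0) := by
        intro k l
        have hk := k.2
        have hl := l.2
        rcases (by omega : k.val + 1 = 5 * n ∨ k.val + 1 < 5 * n) with h | h
        · rw [h, Nat.mod_self]; omega
        · rw [Nat.mod_eq_of_lt h]; omega
      have hne : k.val ≠ l.val := Fin.val_ne_of_ne hkl
      rw [hH _ _ (Sum.inr_injective.ne hkl), hmod, hmod]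
      simp only [av, hv, wv, Sum.elim_inr, add_sub_cancel]
      rw [hYY k l k.2 l.2, hYY l k l.2 k.2]
      have hk := k.2
      have hl := l.2
      omega
  · intro i
    left
    intro k
    rw [hH _ _ Sum.inl_ne_inr]
    simp only [av, hv, wv, Sum.elim_inr, Sum.elim_inl, add_sub_cancel]
    rw [hYX k i k.2]
    refine or_iff_right ?_
    rintro ⟨h1, h2, h3⟩
    exact (hXY i k k.2 h1 h3).not_gt h2
  · intro u v huv hmem
    rw [mem_LShape_iff (hhv u) (hwv u)] at hmem
    rcases hmem with ⟨h1, h2, -⟩ | ⟨h1, -, -⟩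
    · rcases u with i | k <;> rcases v with j | l <;>
        simp only [av, hv, wv, Sum.elim_inr, Sum.elim_inl, add_sub_cancel] at h1 h2
      · refine R.endpoint_off i j (fun h => huv (congrArg _ h)) ?_
        rw [mem_LShape_iff (R.ht_pos i) (R.wd_pos i)]
        exact Or.inl ⟨h1, h2, by linarith [R.ht_pos j]⟩
      · exact hEX l i l.2 h1
      · linarith [hXY j k k.2 (by linarith [R.wd_pos j]) h1.ge]
      · exact hEY l k l.2 k.2 h1
    · exact hhv_inj.ne huv (neg_injective h1).symm
  · intro u v huv
    exact and_iff_right huv
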